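/- Let γ be the standard Gaussian probability measure on ℝ and μ := ⊗_{n∈ℕ} γ on ℝ^ℕ. Let (a_n) and (b_n) be sequences with a_n ≤ 0 and b_n ≤ 0 for all n, such that both ∏_{n=1}^N γ([a_n,∞)) and ∏_{n=1}^N γ([b_n,∞)) converge to strictly positive limits; set A := {y ∈ ℝ^ℕ : y_n ≥ a_n for all n} and B := {y ∈ ℝ^ℕ : y_n ≥ b_n for all n}. Let (V^A_x)_{x∈ℝ₊^∞} and (V^B_x)_{x∈ℝ₊^∞} be the families of isometries on L²(A) and L²(B) respectively determined by the formulas: for x ∈ ℝ₊^∞ with x_n = 0 for n > k, (V^A_x f)(y) = (∏_{n=1}^k e^{(2 x_n y_n − x_n²)/2})^{1/2} f(y−x) if y−x ∈ A and 0 otherwise (μ-a.e. y ∈ A), and analogously for V^B on B. Then there exists a unitary U : L²(A) → L²(B) with U V^A_x = V^B_x U for all x ∈ ℝ₊^∞ if and only if Σ_{n=1}^∞ (a_n − b_n)² < ∞. -/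

import Mathlib

open ContinuousLinearMap Filter Topology MeasureTheory

/-- `μ` is the infinite product `⊗_{n∈ℕ} γ` of the standard Gaussian measure `γ` on `ℝ`:
it is a probability measure whose values on cylinder sets are the corresponding finite
products of Gaussian measures. -/
def IsGaussianProduct (μ : Measure (ℕ → ℝ)) : Prop :=
  IsProbabilityMeasure μ ∧
  ∀ (k : ℕ) (s : ℕ → Set ℝ), (∀ n, MeasurableSet (s n)) → (∀ n, k ≤ n → s n = Set.univ) →
    μ {y : ℕ → ℝ | ∀ n, y n ∈ s n}
      = ∏ n ∈ Finset.range k, ProbabilityTheory.gaussianReal 0 1 (s n)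

/-- `V` is the family of isometries `V^A` on `L²(A) = Lp ℂ 2 (μ.restrict A)` determined by
`(V_x f)(y) = (∏_{n<k} e^{(2 x_n y_n - x_n²)/2})^{1/2} f(y - x)` if `y - x ∈ A`, `0`
otherwise, for `x ∈ ℝ₊^∞` supported in the first `k` coordinates. -/
def IsGaussianShiftRep (μ : Measure (ℕ → ℝ)) (A : Set (ℕ → ℝ))
    (V : (ℕ → NNReal) → (Lp ℂ 2 (μ.restrict A) →L[ℂ] Lp ℂ 2 (μ.restrict A))) : Prop :=
  (∀ x : ℕ → NNReal, (∃ k, ∀ n, k ≤ n → x n = 0) →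
    ∀ f : Lp ℂ 2 (μ.restrict A), ‖V x f‖ = ‖f‖) ∧
  ∀ (x : ℕ → NNReal) (k : ℕ), (∀ n, k ≤ n → x n = 0) →
    ∀ f : Lp ℂ 2 (μ.restrict A),
      (V x f : (ℕ → ℝ) → ℂ) =ᵐ[μ.restrict A]
        Set.indicator {y : ℕ → ℝ | (fun n => y n - (x n : ℝ)) ∈ A}
          (fun y => (Real.sqrt (∏ n ∈ Finset.range k,
              Real.exp ((2 * (x n : ℝ) * y n - (x n : ℝ) ^ 2) / 2)) : ℂ)
            * f (fun n => y n - (x n : ℝ)))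

open scoped ENNReal

/-- The standard Gaussian measure on `ℕ → ℝ`. -/
noncomputable def stdGaussianSeq : Measure (ℕ → ℝ) :=
  Measure.infinitePi fun _ : ℕ => ProbabilityTheory.gaussianReal 0 1

instance : IsProbabilityMeasure stdGaussianSeq := by
  unfold stdGaussianSeq; infer_instance

theorem IsGaussianProduct.eq_stdGaussianSeq {μ : Measure (ℕ → ℝ)} (hμ : IsGaussianProduct μ) :
    μ = stdGaussianSeq := by
  classical
  refine Measure.eq_infinitePi _ fun s t ht => ?_
  obtain ⟨k, hk⟩ : ∃ k, s ⊆ Finset.range k := s.exists_nat_subset_range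
  have h := hμ.2 k (fun n => if n ∈ s then t n else Set.univ)
    (fun n => by split_ifs; exacts [ht n, .univ])
    (fun n hn => if_neg fun hs => absurd (Finset.mem_range.1 (hk hs)) (by omega))
  have hset : {y : ℕ → ℝ | ∀ n, y n ∈ (if n ∈ s then t n else Set.univ)} = Set.pi s t := by
    ext y
    simp only [Set.mem_ofPred_eq, Set.mem_pi, Finset.mem_coe]
    refine forall_congr' fun n => ?_
    split_ifs with hn <;> simp [hn]
  rw [hset] at h
  rw [h, ← Finset.prod_subset hk]
  · exact Finset.prod_congr rfl fun n hn => by simp [hn]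
  · intro n _ hn
    simp [hn]

theorem lintegral_prod_stdGaussianSeq (s : Finset ℕ) {g : ℕ → ℝ → ℝ≥0∞}
    (hg : ∀ n, Measurable (g n)) :
    ∫⁻ y, ∏ n ∈ s, g n (y n) ∂stdGaussianSeq
      = ∏ n ∈ s, ∫⁻ t, g n t ∂ProbabilityTheory.gaussianReal 0 1 := by
  rw [stdGaussianSeq, ProbabilityTheory.lintegral_prod_eq_prod_lintegral_of_indepFun s
    (fun n (y : ℕ → ℝ) => g n (y n)) (ProbabilityTheory.iIndepFun_infinitePi hg)
    (fun n => (hg n).comp (measurable_pi_apply n))]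
  refine Finset.prod_congr rfl fun n _ => ?_
  exact (measurePreserving_eval_infinitePi
    (fun _ : ℕ => ProbabilityTheory.gaussianReal 0 1) n).lintegral_comp (hg n)

/-- The density of the translate by `h`, truncated to the first `N` coordinates. -/
noncomputable def shiftDensity (h : ℕ → ℝ) (N : ℕ) (y : ℕ → ℝ) : ℝ :=
  ∏ n ∈ Finset.range N, Real.exp ((2 * h n * y n - h n ^ 2) / 2)

theorem shiftDensity_pos (h : ℕ → ℝ) (N : ℕ) (y : ℕ → ℝ) : 0 < shiftDensity h N y :=
  Finset.prod_pos fun _ _ => Real.exp_pos _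

theorem measurable_shiftDensity (h : ℕ → ℝ) (N : ℕ) : Measurable (shiftDensity h N) := by
  unfold shiftDensity
  fun_prop

theorem shiftDensity_eq_of_le {h : ℕ → ℝ} {k N : ℕ} (hk : ∀ n, k ≤ n → h n = 0) (hN : k ≤ N)
    (y : ℕ → ℝ) : shiftDensity h N y = shiftDensity h k y := by
  refine (Finset.prod_subset (Finset.range_mono hN) fun n _ hn => ?_).symm
  simp [hk n (by simpa using hn)]

theorem shiftDensity_sub (h x : ℕ → ℝ) (N : ℕ) (y : ℕ → ℝ) :
    shiftDensity h N (fun n => y n - x n)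
      = shiftDensity h N y * Real.exp (-∑ n ∈ Finset.range N, h n * x n) := by
  rw [← Finset.sum_neg_distrib, Real.exp_sum, shiftDensity, shiftDensity,
    ← Finset.prod_mul_distrib]
  refine Finset.prod_congr rfl fun n _ => ?_
  rw [← Real.exp_add]
  ring_nf

theorem setLIntegral_exp_gaussianReal (c : ℝ) {s : Set ℝ} (hs : MeasurableSet s) :
    ∫⁻ t in s, ENNReal.ofReal (Real.exp ((2 * c * t - c ^ 2) / 2))
      ∂ProbabilityTheory.gaussianReal 0 1 = ProbabilityTheory.gaussianReal c 1 s := by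
  rw [ProbabilityTheory.gaussianReal_of_var_ne_zero _ one_ne_zero,
    ProbabilityTheory.gaussianReal_of_var_ne_zero _ one_ne_zero, withDensity_apply _ hs,
    restrict_withDensity hs, lintegral_withDensity_eq_lintegral_mul _
      (ProbabilityTheory.measurable_gaussianPDF 0 1) (by fun_prop)]
  refine lintegral_congr fun t => ?_
  simp only [Pi.mul_apply, ProbabilityTheory.gaussianPDF, ProbabilityTheory.gaussianPDFReal]
  rw [← ENNReal.ofReal_mul (by positivity), mul_assoc, ← Real.exp_add]
  congr 3
  simp
  ring

theorem setLIntegral_shiftDensity (h : ℕ → ℝ) {N : ℕ} {s : Finset ℕ} (hs : s ⊆ Finset.range N)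
    {t : ℕ → Set ℝ} (ht : ∀ n, MeasurableSet (t n)) :
    ∫⁻ y in Set.pi s t, ENNReal.ofReal (shiftDensity h N y) ∂stdGaussianSeq
      = ∏ n ∈ s, ProbabilityTheory.gaussianReal (h n) 1 (t n) := by
  classical
  have hmeas : MeasurableSet (Set.pi (s : Set ℕ) t) :=
    MeasurableSet.pi s.countable_toSet fun n _ => ht n
  set T : ℕ → Set ℝ := fun n => if n ∈ s then t n else Set.univ with hT
  have hTm : ∀ n, MeasurableSet (T n) := fun n => by
    simp only [hT]; split_ifs; exacts [ht n, .univ]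
  have key : ∀ y, (Set.pi (s : Set ℕ) t).indicator
      (fun y => ENNReal.ofReal (shiftDensity h N y)) y
      = ∏ n ∈ Finset.range N, (T n).indicator
        (fun u => ENNReal.ofReal (Real.exp ((2 * h n * u - h n ^ 2) / 2))) (y n) := by
    intro y
    by_cases hy : y ∈ Set.pi (s : Set ℕ) t
    · rw [Set.indicator_of_mem hy, shiftDensity,
        ENNReal.ofReal_prod_of_nonneg fun _ _ => (Real.exp_pos _).le]
      refine Finset.prod_congr rfl fun n _ => ?_
      rw [Set.indicator_of_mem]
      by_cases hn : n ∈ s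
      · simpa [hT, hn] using hy n hn
      · simp [hT, hn]
    · rw [Set.indicator_of_notMem hy]
      simp only [Set.mem_pi, not_forall] at hy
      obtain ⟨n, hn, hyn⟩ := hy
      have hyT : y n ∉ T n := by rwa [show T n = t n from if_pos hn]
      exact (Finset.prod_eq_zero (hs hn) (Set.indicator_of_notMem hyT _)).symm
  rw [← lintegral_indicator hmeas, lintegral_congr key,
    lintegral_prod_stdGaussianSeq _ fun n => Measurable.indicator (by fun_prop) (hTm n),
    ← Finset.prod_subset hs]
  · refine Finset.prod_congr rfl fun n hn => ?_
    rw [lintegral_indicator (hTm n), setLIntegral_exp_gaussianReal _ (hTm n)]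
    simp [hT, hn]
  · intro n _ hn
    rw [lintegral_indicator (hTm n), setLIntegral_exp_gaussianReal _ (hTm n)]
    simp [hT, hn]

theorem lintegral_shiftDensity (h : ℕ → ℝ) (N : ℕ) :
    ∫⁻ y, ENNReal.ofReal (shiftDensity h N y) ∂stdGaussianSeq = 1 := by
  simpa using setLIntegral_shiftDensity h (N := N) (Finset.empty_subset _) (t := fun _ => ∅)
    (fun _ => .empty)

theorem map_add_stdGaussianSeq (h : ℕ → ℝ) :
    stdGaussianSeq.map (fun y n => y n + h n)
      = Measure.infinitePi fun n => ProbabilityTheory.gaussianReal (h n) 1 := by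
  rw [stdGaussianSeq, Measure.infinitePi_map_pi _ fun n => measurable_add_const (h n)]
  simp [ProbabilityTheory.gaussianReal_map_add_const]

theorem withDensity_eq_map_add {h : ℕ → ℝ} {ρ : (ℕ → ℝ) → ℝ≥0∞}
    (hρ : ∀ (s : Finset ℕ) (t : ℕ → Set ℝ), (∀ n, MeasurableSet (t n)) →
      ∫⁻ y in Set.pi s t, ρ y ∂stdGaussianSeq
        = ∏ n ∈ s, ProbabilityTheory.gaussianReal (h n) 1 (t n)) :
    stdGaussianSeq.withDensity ρ = stdGaussianSeq.map (fun y n => y n + h n) := by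
  rw [map_add_stdGaussianSeq]
  refine Measure.eq_infinitePi _ fun s t ht => ?_
  rw [withDensity_apply _ (MeasurableSet.pi s.countable_toSet fun n _ => ht n), hρ s t ht]

theorem withDensity_shiftDensity_of_finite {h : ℕ → ℝ} {k : ℕ} (hk : ∀ n, k ≤ n → h n = 0) :
    stdGaussianSeq.withDensity (fun y => ENNReal.ofReal (shiftDensity h k y))
      = stdGaussianSeq.map (fun y n => y n + h n) := by
  refine withDensity_eq_map_add fun s t ht => ?_
  obtain ⟨m, hm⟩ := s.exists_nat_subset_range
  rw [← setLIntegral_shiftDensity h (N := max m k)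
    (hm.trans (Finset.range_mono (le_max_left _ _))) ht]
  simp_rw [shiftDensity_eq_of_le hk (le_max_right m k)]

theorem shiftDensity_mul (h : ℕ → ℝ) {N M : ℕ} (hNM : N ≤ M) (y : ℕ → ℝ) :
    shiftDensity h N y * shiftDensity h M y
      = shiftDensity (fun n => if n < N then 2 * h n else h n) M y
        * Real.exp (∑ n ∈ Finset.range N, h n ^ 2) := by
  have hfil : (Finset.range M).filter (· < N) = Finset.range N := by
    ext n; simp; omega
  rw [Real.exp_sum]
  simp only [shiftDensity]
  simp_rw [← hfil, Finset.prod_filter, ← Finset.prod_mul_distrib]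
  refine Finset.prod_congr rfl fun n _ => ?_
  split_ifs
  · rw [← Real.exp_add, ← Real.exp_add]
    ring_nf
  · ring

theorem integrable_shiftDensity (h : ℕ → ℝ) (N : ℕ) :
    Integrable (shiftDensity h N) stdGaussianSeq := by
  refine ⟨(measurable_shiftDensity h N).aestronglyMeasurable, ?_⟩
  rw [hasFiniteIntegral_iff_ofReal (ae_of_all _ fun y => (shiftDensity_pos h N y).le),
    lintegral_shiftDensity]
  exact ENNReal.one_lt_top

theorem integral_shiftDensity (h : ℕ → ℝ) (N : ℕ) :
    ∫ y, shiftDensity h N y ∂stdGaussianSeq = 1 := by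
  rw [integral_eq_lintegral_of_nonneg_ae (ae_of_all _ fun y => (shiftDensity_pos h N y).le)
    (measurable_shiftDensity h N).aestronglyMeasurable, lintegral_shiftDensity, ENNReal.toReal_one]

theorem memLp_shiftDensity (h : ℕ → ℝ) (N : ℕ) :
    MemLp (shiftDensity h N) 2 stdGaussianSeq := by
  rw [memLp_two_iff_integrable_sq (measurable_shiftDensity h N).aestronglyMeasurable]
  simp_rw [sq, shiftDensity_mul h le_rfl]
  exact (integrable_shiftDensity _ _).mul_const _

theorem integral_shiftDensity_mul (h : ℕ → ℝ) {N M : ℕ} (hNM : N ≤ M) :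
    ∫ y, shiftDensity h N y * shiftDensity h M y ∂stdGaussianSeq
      = Real.exp (∑ n ∈ Finset.range N, h n ^ 2) := by
  simp_rw [shiftDensity_mul h hNM]
  rw [integral_mul_const, integral_shiftDensity, one_mul]

theorem cauchySeq_shiftDensity {h : ℕ → ℝ} (hh : Summable fun n => h n ^ 2) :
    CauchySeq fun N => (memLp_shiftDensity h N).toLp := by
  set s : ℕ → ℝ := fun N => Real.exp (∑ n ∈ Finset.range N, h n ^ 2) with hs
  have hc : CauchySeq s :=
    ((Real.continuous_exp.tendsto _).comp hh.hasSum.tendsto_sum_nat).cauchySeq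
  have hinner : ∀ N M, N ≤ M → inner ℝ (memLp_shiftDensity h N).toLp
      (memLp_shiftDensity h M).toLp = s N := by
    intro N M hNM
    rw [L2.inner_def, hs]
    dsimp only
    rw [← integral_shiftDensity_mul h hNM]
    refine integral_congr_ae ?_
    filter_upwards [(memLp_shiftDensity h N).coeFn_toLp, (memLp_shiftDensity h M).coeFn_toLp]
      with y hy hy'
    rw [hy, hy']
    simp [mul_comm]
  rw [Metric.cauchySeq_iff'] at hc ⊢
  intro ε hε
  obtain ⟨N, hN⟩ := hc (ε ^ 2) (by positivity)
  refine ⟨N, fun M hM => ?_⟩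
  have h1 := hN M hM
  rw [Real.dist_eq] at h1
  rw [dist_eq_norm]
  refine lt_of_pow_lt_pow_left₀ 2 hε.le (lt_of_eq_of_lt ?_ (lt_of_abs_lt h1))
  rw [norm_sub_sq_real, ← real_inner_self_eq_norm_sq, ← real_inner_self_eq_norm_sq,
    hinner _ _ le_rfl, hinner _ _ le_rfl, real_inner_comm, hinner _ _ hM]
  ring

/-- Cameron–Martin: a square-summable translate of the Gaussian measure has a density, which is
an almost everywhere limit of the truncated densities. -/
theorem exists_density_of_summable_sq {h : ℕ → ℝ} (hh : Summable fun n => h n ^ 2) :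
    ∃ D : (ℕ → ℝ) → ℝ, Measurable D ∧
      stdGaussianSeq.withDensity (fun y => ENNReal.ofReal (D y))
        = stdGaussianSeq.map (fun y n => y n + h n) ∧
      ∃ ns : ℕ → ℕ, Tendsto ns atTop atTop ∧
        ∀ᵐ y ∂stdGaussianSeq, Tendsto (fun k => shiftDensity h (ns k) y) atTop (𝓝 (D y)) := by
  obtain ⟨F, hF⟩ := cauchySeq_tendsto_of_complete (cauchySeq_shiftDensity hh)
  have hF2 : Tendsto (fun N => eLpNorm (shiftDensity h N - (F : (ℕ → ℝ) → ℝ)) 2 stdGaussianSeq)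
      atTop (𝓝 0) := by
    have := (Lp.tendsto_Lp_iff_tendsto_eLpNorm' _ _).1 hF
    refine this.congr fun N => eLpNorm_congr_ae ?_
    filter_upwards [(memLp_shiftDensity h N).coeFn_toLp] with y hy
    simp [hy]
  have hF1 : Tendsto (fun N => eLpNorm (shiftDensity h N - (F : (ℕ → ℝ) → ℝ)) 1 stdGaussianSeq)
      atTop (𝓝 0) :=
    tendsto_of_tendsto_of_tendsto_of_le_of_le tendsto_const_nhds hF2 (fun _ => zero_le)
      fun N => eLpNorm_le_eLpNorm_of_exponent_le (by norm_num)
        ((measurable_shiftDensity h N).aestronglyMeasurable.sub (Lp.aestronglyMeasurable F))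
  obtain ⟨ns, hns, hae⟩ := (tendstoInMeasure_of_tendsto_eLpNorm two_ne_zero
    (fun N => (measurable_shiftDensity h N).aestronglyMeasurable)
    (Lp.aestronglyMeasurable F) hF2).exists_seq_tendsto_ae
  have hF0 : ∀ᵐ y ∂stdGaussianSeq, 0 ≤ F y := by
    filter_upwards [hae] with y hy
    exact ge_of_tendsto' hy fun k => (shiftDensity_pos h _ y).le
  have hFi : Integrable F stdGaussianSeq := (Lp.memLp F).integrable one_le_two
  refine ⟨F, (Lp.stronglyMeasurable F).measurable, ?_, ns, hns.tendsto_atTop, hae⟩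
  refine withDensity_eq_map_add fun s t ht => ?_
  obtain ⟨m, hm⟩ := s.exists_nat_subset_range
  have hlim := tendsto_setIntegral_of_L1' (F : (ℕ → ℝ) → ℝ)
    (Lp.aestronglyMeasurable F)
    (Eventually.of_forall fun N => integrable_shiftDensity h N) hF1 (Set.pi (s : Set ℕ) t)
  have hconst : ∀ N ≥ m, ∫ y in Set.pi (s : Set ℕ) t, shiftDensity h N y ∂stdGaussianSeq
      = (∏ n ∈ s, ProbabilityTheory.gaussianReal (h n) 1 (t n)).toReal := by
    intro N hN
    rw [integral_eq_lintegral_of_nonneg_ae (ae_of_all _ fun y => (shiftDensity_pos h N y).le)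
      (measurable_shiftDensity h N).aestronglyMeasurable,
      setLIntegral_shiftDensity h (hm.trans (Finset.range_mono hN)) ht]
  have heq := tendsto_nhds_unique hlim
    (tendsto_const_nhds.congr' ((eventually_ge_atTop m).mono fun N hN => (hconst N hN).symm))
  rw [integral_eq_lintegral_of_nonneg_ae (ae_restrict_of_ae hF0)
    (Lp.aestronglyMeasurable F).restrict] at heq
  refine (ENNReal.toReal_eq_toReal_iff' ?_ ?_).1 heq
  · exact ne_top_of_le_ne_top hFi.lintegral_lt_top.ne (setLIntegral_le_lintegral _ _)
  · exact ENNReal.prod_ne_top fun n _ => measure_ne_top _ _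

theorem map_add_absolutelyContinuous {h : ℕ → ℝ} (hh : Summable fun n => h n ^ 2) :
    stdGaussianSeq.map (fun y n => y n + h n) ≪ stdGaussianSeq := by
  obtain ⟨D, _, hD, _⟩ := exists_density_of_summable_sq hh
  exact hD ▸ withDensity_absolutelyContinuous _ _

theorem quasiMeasurePreserving_sub {h : ℕ → ℝ} (hh : Summable fun n => h n ^ 2) :
    Measure.QuasiMeasurePreserving (fun y n => y n - h n) stdGaussianSeq stdGaussianSeq :=
  ⟨by fun_prop, by
    simpa [sub_eq_add_neg] using map_add_absolutelyContinuous (h := fun n => -h n) (by simpa)⟩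

theorem summable_sq_of_finite {x : ℕ → ℝ} {k : ℕ} (hx : ∀ n, k ≤ n → x n = 0) :
    Summable fun n => x n ^ 2 :=
  summable_of_ne_finset_zero (s := Finset.range k) fun n hn => by simp [hx n (by simpa using hn)]

/-- The density can be chosen positive, with the cocycle identity for finitely supported
translations. -/
theorem exists_pos_density_of_summable_sq {h : ℕ → ℝ} (hh : Summable fun n => h n ^ 2) :
    ∃ D : (ℕ → ℝ) → ℝ, Measurable D ∧ (∀ y, 0 < D y) ∧
      stdGaussianSeq.withDensity (fun y => ENNReal.ofReal (D y))
        = stdGaussianSeq.map (fun y n => y n + h n) ∧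
      ∀ (x : ℕ → ℝ) (k : ℕ), (∀ n, k ≤ n → x n = 0) → ∀ᵐ y ∂stdGaussianSeq,
        D (fun n => y n - x n) = D y * Real.exp (-∑ n ∈ Finset.range k, h n * x n) := by
  obtain ⟨D, hDm, hD, ns, hns, hlim⟩ := exists_density_of_summable_sq hh
  have hpos : ∀ᵐ y ∂stdGaussianSeq, 0 < D y := by
    have hm : MeasurableSet {y | ¬ 0 < D y} := (measurableSet_lt measurable_const hDm).compl
    have h0 : stdGaussianSeq.map (fun y n => y n + h n) {y | ¬ 0 < D y} = 0 := by
      rw [← hD, withDensity_apply _ hm]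
      refine (setLIntegral_congr_fun (g := fun _ => 0) hm fun y hy => ?_).trans (by simp)
      exact ENNReal.ofReal_of_nonpos (not_lt.1 hy)
    rw [Measure.map_apply (by fun_prop) hm] at h0
    have h1 := (quasiMeasurePreserving_sub hh).preimage_null h0
    simpa [ae_iff] using h1
  have hae : (fun y => if 0 < D y then D y else 1) =ᵐ[stdGaussianSeq] D := by
    filter_upwards [hpos] with y hy
    simp [hy]
  refine ⟨fun y => if 0 < D y then D y else 1,
    Measurable.ite (measurableSet_lt measurable_const hDm) hDm measurable_const,
    fun y => by dsimp only; split_ifs with hy; exacts [hy, one_pos], ?_, fun x k hx => ?_⟩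
  · rw [← hD]
    exact withDensity_congr_ae (hae.fun_comp ENNReal.ofReal)
  · have hq := quasiMeasurePreserving_sub (summable_sq_of_finite hx)
    filter_upwards [hae, hq.ae hae, hlim, hq.ae hlim] with y hy1 hy2 hy3 hy4
    rw [hy1, hy2]
    refine tendsto_nhds_unique hy4 ((hy3.mul_const _).congr' ?_)
    filter_upwards [hns.eventually_ge_atTop k] with j hj
    rw [shiftDensity_sub]
    congr 3
    refine Finset.sum_subset (Finset.range_mono hj) fun n _ hn => ?_
    simp [hx n (by simpa using hn)]

section WeightedComposition

variable {X Y : Type*} [MeasurableSpace X] [MeasurableSpace Y] {ν : Measure X} {κ : Measure Y}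

theorem eLpNorm_sqrt_mul_comp {D : Y → ℝ} (hDm : Measurable D) (hD : ∀ y, 0 < D y) {e : Y → X}
    (he : MeasurePreserving e (κ.withDensity fun y => ENNReal.ofReal (D y)) ν) {f : X → ℂ}
    (hf : AEStronglyMeasurable f ν) :
    eLpNorm (fun y => (Real.sqrt (D y) : ℂ) * f (e y)) 2 κ = eLpNorm f 2 ν := by
  rw [← eLpNorm_comp_measurePreserving hf he,
    eLpNorm_eq_lintegral_rpow_enorm_toReal two_ne_zero ENNReal.ofNat_ne_top,
    eLpNorm_eq_lintegral_rpow_enorm_toReal two_ne_zero ENNReal.ofNat_ne_top,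
    lintegral_withDensity_eq_lintegral_mul_non_measurable _ (by fun_prop)
      (ae_of_all _ fun _ => ENNReal.ofReal_lt_top)]
  congr 1
  refine lintegral_congr fun y => ?_
  simp only [ENNReal.toReal_ofNat, ENNReal.rpow_ofNat, enorm_mul, mul_pow, Pi.mul_apply,
    Function.comp_apply]
  congr 1
  rw [← ofReal_norm, ← ENNReal.ofReal_pow (norm_nonneg _), Complex.norm_real,
    Real.norm_of_nonneg (Real.sqrt_nonneg _), Real.sq_sqrt (hD y).le]

theorem quasiMeasurePreserving_of_withDensity {D : Y → ℝ} (hDm : Measurable D)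
    (hD : ∀ y, 0 < D y) {e : Y → X}
    (he : MeasurePreserving e (κ.withDensity fun y => ENNReal.ofReal (D y)) ν) :
    Measure.QuasiMeasurePreserving e κ ν := by
  refine he.quasiMeasurePreserving.mono_left ?_
  exact withDensity_absolutelyContinuous' (by fun_prop)
    (ae_of_all _ fun y => by simpa using hD y)

/-- The unitary `f ↦ √D · (f ∘ e)` attached to an isomorphism `e` of measure spaces after
weighting by `D`. -/
theorem exists_weighted_composition {D : Y → ℝ} (hDm : Measurable D)
    (hD : ∀ y, 0 < D y) (e : Y ≃ᵐ X)
    (he : MeasurePreserving e (κ.withDensity fun y => ENNReal.ofReal (D y)) ν) :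
    ∃ U : Lp ℂ 2 ν ≃ₗᵢ[ℂ] Lp ℂ 2 κ,
      ∀ f : Lp ℂ 2 ν, (U f : Y → ℂ) =ᵐ[κ] fun y => (Real.sqrt (D y) : ℂ) * f (e y) := by
  have hq := quasiMeasurePreserving_of_withDensity hDm hD he
  have hmem : ∀ f : X → ℂ, MemLp f 2 ν → MemLp (fun y => (Real.sqrt (D y) : ℂ) * f (e y)) 2 κ := by
    intro f hf
    refine ⟨?_, (eLpNorm_sqrt_mul_comp hDm hD he hf.1).trans_lt hf.2⟩
    exact (by fun_prop : Measurable fun y => (Real.sqrt (D y) : ℂ)).aestronglyMeasurable.mul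
      (hf.1.comp_quasiMeasurePreserving hq)
  let T : Lp ℂ 2 ν →ₗᵢ[ℂ] Lp ℂ 2 κ :=
    { toFun := fun f => (hmem f (Lp.memLp f)).toLp
      map_add' := fun f g => by
        refine Lp.ext ?_
        filter_upwards [(hmem _ (Lp.memLp (f + g))).coeFn_toLp, (hmem _ (Lp.memLp f)).coeFn_toLp,
          (hmem _ (Lp.memLp g)).coeFn_toLp, hq.ae (Lp.coeFn_add f g),
          Lp.coeFn_add (hmem _ (Lp.memLp f)).toLp (hmem _ (Lp.memLp g)).toLp]
          with y h1 h2 h3 h4 h5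
        rw [h1, h5, Pi.add_apply, h2, h3, h4, Pi.add_apply, mul_add]
      map_smul' := fun c f => by
        refine Lp.ext ?_
        filter_upwards [(hmem _ (Lp.memLp (c • f))).coeFn_toLp, (hmem _ (Lp.memLp f)).coeFn_toLp,
          hq.ae (Lp.coeFn_smul c f), Lp.coeFn_smul c (hmem _ (Lp.memLp f)).toLp]
          with y h1 h2 h3 h4
        rw [h1, RingHom.id_apply, h4, Pi.smul_apply, h2, h3, Pi.smul_apply, smul_eq_mul,
          smul_eq_mul, mul_left_comm]
      norm_map' := fun f => by
        change ‖(hmem f (Lp.memLp f)).toLp‖ = ‖f‖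
        rw [Lp.norm_toLp, Lp.norm_def,
          eLpNorm_sqrt_mul_comp hDm hD he (Lp.aestronglyMeasurable f)] }
  have hT : ∀ f : Lp ℂ 2 ν, (T f : Y → ℂ) =ᵐ[κ] fun y => (Real.sqrt (D y) : ℂ) * f (e y) :=
    fun f => (hmem f (Lp.memLp f)).coeFn_toLp
  have hsurj : Function.Surjective T := by
    intro g
    set f : X → ℂ := fun x => (Real.sqrt (D (e.symm x)) : ℂ)⁻¹ * g (e.symm x) with hf
    have hfe : ∀ y, (Real.sqrt (D y) : ℂ) * f (e y) = g y := fun y => by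
      have : (Real.sqrt (D y) : ℂ) ≠ 0 := by
        exact_mod_cast (Real.sqrt_pos.2 (hD y)).ne'
      simp [hf, mul_inv_cancel_left₀ this]
    have hfm : AEStronglyMeasurable f ν := by
      have hm : Measurable fun x => (Real.sqrt (D (e.symm x)) : ℂ)⁻¹ := by fun_prop
      have hs : Measurable fun x => g (e.symm x) :=
        (Lp.stronglyMeasurable g).measurable.comp e.symm.measurable
      exact (hm.mul hs).aestronglyMeasurable
    have hfL : MemLp f 2 ν := by
      refine ⟨hfm, ?_⟩
      rw [← eLpNorm_sqrt_mul_comp hDm hD he hfm]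
      simp_rw [hfe]
      exact (Lp.memLp g).2
    refine ⟨hfL.toLp, Lp.ext ?_⟩
    filter_upwards [hT hfL.toLp, hq.ae hfL.coeFn_toLp] with y h1 h2
    rw [h1, h2, hfe]
  exact ⟨LinearIsometryEquiv.ofSurjective T hsurj, hT⟩

end WeightedComposition

/-- Translation by `h` as a measurable equivalence. -/
def subMeasurableEquiv (h : ℕ → ℝ) : (ℕ → ℝ) ≃ᵐ (ℕ → ℝ) where
  toFun y n := y n - h n
  invFun y n := y n + h n
  left_inv y := by simp
  right_inv y := by simp
  measurable_toFun := by simp only [Equiv.coe_fn_mk]; fun_prop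
  measurable_invFun := by simp only [Equiv.coe_fn_symm_mk]; fun_prop

theorem measurePreserving_sub {h : ℕ → ℝ} {D : (ℕ → ℝ) → ℝ}
    (hD : stdGaussianSeq.withDensity (fun y => ENNReal.ofReal (D y))
      = stdGaussianSeq.map (fun y n => y n + h n)) {A A' : Set (ℕ → ℝ)} (hA : MeasurableSet A)
    (hA' : ∀ y, y ∈ A' ↔ (fun n => y n - h n) ∈ A) :
    MeasurePreserving (subMeasurableEquiv h)
      ((stdGaussianSeq.restrict A').withDensity fun y => ENNReal.ofReal (D y))
      (stdGaussianSeq.restrict A) := by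
  have hpre : A' = subMeasurableEquiv h ⁻¹' A := Set.ext hA'
  have hm : MeasurableSet A' := hpre ▸ (subMeasurableEquiv h).measurable hA
  have hmp : MeasurePreserving (subMeasurableEquiv h)
      (stdGaussianSeq.withDensity fun y => ENNReal.ofReal (D y)) stdGaussianSeq := by
    refine ⟨(subMeasurableEquiv h).measurable, ?_⟩
    rw [hD, Measure.map_map (subMeasurableEquiv h).measurable (by fun_prop)]
    convert Measure.map_id
    ext y
    simp [subMeasurableEquiv]
  rw [← restrict_withDensity hm, hpre]
  exact hmp.restrict_preimage hA

theorem measurableSet_forall_le (a : ℕ → ℝ) : MeasurableSet {y : ℕ → ℝ | ∀ n, a n ≤ y n} := by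
  rw [Set.ofPred_forall]
  exact MeasurableSet.iInter fun n => measurableSet_le measurable_const (measurable_pi_apply n)

theorem exists_intertwiner_of_summable {a b : ℕ → ℝ} {A B : Set (ℕ → ℝ)}
    (hA : A = {y | ∀ n, a n ≤ y n}) (hB : B = {y | ∀ n, b n ≤ y n})
    {VA : (ℕ → NNReal) → (Lp ℂ 2 (stdGaussianSeq.restrict A) →L[ℂ]
      Lp ℂ 2 (stdGaussianSeq.restrict A))} (hVA : IsGaussianShiftRep stdGaussianSeq A VA)
    {VB : (ℕ → NNReal) → (Lp ℂ 2 (stdGaussianSeq.restrict B) →L[ℂ]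
      Lp ℂ 2 (stdGaussianSeq.restrict B))} (hVB : IsGaussianShiftRep stdGaussianSeq B VB)
    (hab : Summable fun n => (a n - b n) ^ 2) :
    ∃ U : Lp ℂ 2 (stdGaussianSeq.restrict A) ≃ₗᵢ[ℂ] Lp ℂ 2 (stdGaussianSeq.restrict B),
      ∀ x : ℕ → NNReal, (∃ k, ∀ n, k ≤ n → x n = 0) → ∀ f, U (VA x f) = VB x (U f) := by
  set h : ℕ → ℝ := fun n => b n - a n with hh
  have hs : Summable fun n => h n ^ 2 := hab.congr fun n => by simp only [hh]; ring
  have hAB : ∀ y, y ∈ B ↔ (fun n => y n - h n) ∈ A := fun y => by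
    rw [hA, hB]
    refine forall_congr' fun n => ?_
    simp only [hh]
    constructor <;> intro <;> linarith
  have hBm : MeasurableSet B := hB ▸ measurableSet_forall_le b
  obtain ⟨D, hDm, hD0, hD, hcoc⟩ := exists_pos_density_of_summable_sq hs
  have hmp := measurePreserving_sub hD (hA ▸ measurableSet_forall_le a) hAB
  have hq := quasiMeasurePreserving_of_withDensity hDm hD0 hmp
  obtain ⟨U, hU⟩ := exists_weighted_composition hDm hD0 _ hmp
  refine ⟨U, fun x ⟨k, hk⟩ f => Lp.ext ?_⟩
  have hk' : ∀ n, k ≤ n → (fun n => (x n : ℝ)) n = 0 := fun n hn => by simp [hk n hn]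
  have hUf := (quasiMeasurePreserving_sub (summable_sq_of_finite hk')).ae
    ((ae_restrict_iff' hBm).1 (hU f))
  filter_upwards [hU (VA x f), hq.ae (hVA.2 x k hk f), hVB.2 x k hk (U f),
    ae_restrict_of_ae hUf, ae_restrict_of_ae (hcoc _ k hk')] with y h1 h2 h3 h4 h5
  rw [h1, h2, h3]
  by_cases hy : (fun n => y n - (x n : ℝ)) ∈ B
  · have hy' : (fun n => subMeasurableEquiv h y n - (x n : ℝ)) ∈ A := by
      have := (hAB _).1 hy
      simpa only [subMeasurableEquiv, MeasurableEquiv.coe_mk, Equiv.coe_fn_mk, sub_right_comm]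
        using this
    rw [Set.indicator_of_mem (by exact hy'), Set.indicator_of_mem (by exact hy), h4 hy, h5]
    have harg : (fun n => subMeasurableEquiv h y n - (x n : ℝ))
        = subMeasurableEquiv h fun n => y n - (x n : ℝ) := by
      funext n
      simp only [subMeasurableEquiv, MeasurableEquiv.coe_mk, Equiv.coe_fn_mk, sub_right_comm]
    have hx : (∏ n ∈ Finset.range k, Real.exp ((2 * (x n : ℝ) * subMeasurableEquiv h y n
        - (x n : ℝ) ^ 2) / 2)) = shiftDensity (fun n => (x n : ℝ)) k y
          * Real.exp (-∑ n ∈ Finset.range k, h n * (x n : ℝ)) := by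
      simp_rw [mul_comm (h _)]
      exact shiftDensity_sub _ h k y
    rw [harg, hx, ← mul_assoc, ← mul_assoc, ← Complex.ofReal_mul, ← Complex.ofReal_mul,
      ← Real.sqrt_mul (hD0 y).le,
      ← Real.sqrt_mul (Finset.prod_nonneg fun _ _ => (Real.exp_pos _).le)]
    congr 3
    simp only [shiftDensity]
    ring
  · have hy' : (fun n => subMeasurableEquiv h y n - (x n : ℝ)) ∉ A := by
      intro hc
      refine hy ((hAB _).2 ?_)
      simpa only [subMeasurableEquiv, MeasurableEquiv.coe_mk, Equiv.coe_fn_mk, sub_right_comm]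
        using hc
    rw [Set.indicator_of_notMem (by exact hy'), Set.indicator_of_notMem (by exact hy), mul_zero]

theorem enorm_sq_eq_lintegral {X : Type*} [MeasurableSpace X] {ν : Measure X} (f : Lp ℂ 2 ν) :
    ‖f‖ₑ ^ 2 = ∫⁻ y, ‖f y‖ₑ ^ 2 ∂ν := by
  rw [Lp.enorm_def, eLpNorm_eq_lintegral_rpow_enorm_toReal two_ne_zero ENNReal.ofNat_ne_top,
    ← ENNReal.rpow_natCast, ← ENNReal.rpow_mul]
  simp

section RangeProjection

variable {A : Set (ℕ → ℝ)} {V : (ℕ → NNReal) → (Lp ℂ 2 (stdGaussianSeq.restrict A) →L[ℂ]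
  Lp ℂ 2 (stdGaussianSeq.restrict A))} {x : ℕ → NNReal} {k : ℕ}

theorem setLIntegral_le_enorm_sub_sq (hV : IsGaussianShiftRep stdGaussianSeq A V)
    (hA : MeasurableSet A) (hx : ∀ n, k ≤ n → x n = 0)
    (f g : Lp ℂ 2 (stdGaussianSeq.restrict A)) :
    ∫⁻ y in {y : ℕ → ℝ | (fun n => y n - (x n : ℝ)) ∉ A}, ‖f y‖ₑ ^ 2 ∂stdGaussianSeq.restrict A
      ≤ ‖f - V x g‖ₑ ^ 2 := by
  have hm : MeasurableSet {y : ℕ → ℝ | (fun n => y n - (x n : ℝ)) ∉ A} :=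
    (show Measurable fun (y : ℕ → ℝ) n => y n - (x n : ℝ) by fun_prop) hA.compl
  rw [enorm_sq_eq_lintegral]
  refine le_trans (lintegral_mono_ae ?_) (setLIntegral_le_lintegral _ _)
  rw [ae_restrict_iff' hm]
  filter_upwards [hV.2 x k hx g, Lp.coeFn_sub f (V x g)] with y h1 h2 hy
  rw [h2, Pi.sub_apply, h1, Set.indicator_of_notMem (by exact hy), sub_zero]

theorem exists_setLIntegral_eq_enorm_sub_sq (hV : IsGaussianShiftRep stdGaussianSeq A V)
    (hA : MeasurableSet A) (hx : ∀ n, k ≤ n → x n = 0)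
    (hxA : ∀ y, (fun n => y n - (x n : ℝ)) ∈ A → y ∈ A)
    (f : Lp ℂ 2 (stdGaussianSeq.restrict A)) :
    ∃ g, ∫⁻ y in {y : ℕ → ℝ | (fun n => y n - (x n : ℝ)) ∉ A}, ‖f y‖ₑ ^ 2
      ∂stdGaussianSeq.restrict A = ‖f - V x g‖ₑ ^ 2 := by
  set A' : Set (ℕ → ℝ) := {y | (fun n => y n - (x n : ℝ)) ∈ A} with hA'
  have hA'm : MeasurableSet A' :=
    (show Measurable fun (y : ℕ → ℝ) n => y n - (x n : ℝ) by fun_prop) hA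
  have hle : stdGaussianSeq.restrict A' ≤ stdGaussianSeq.restrict A :=
    Measure.restrict_mono (fun y hy => hxA y hy) le_rfl
  have hx' : ∀ n, k ≤ n → (fun n => (x n : ℝ)) n = 0 := fun n hn => by simp [hx n hn]
  obtain ⟨U, hU⟩ := exists_weighted_composition (measurable_shiftDensity _ k)
    (shiftDensity_pos _ k) _ (measurePreserving_sub (withDensity_shiftDensity_of_finite hx') hA
      (A' := A') fun _ => Iff.rfl)
  have hfL : MemLp f 2 (stdGaussianSeq.restrict A') := (Lp.memLp f).mono_measure hle
  refine ⟨U.symm hfL.toLp, ?_⟩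
  have h1 := hU (U.symm hfL.toLp)
  rw [LinearIsometryEquiv.apply_symm_apply] at h1
  have h2 := (ae_restrict_iff' hA'm).1 (h1.symm.trans hfL.coeFn_toLp)
  rw [enorm_sq_eq_lintegral, ← lintegral_indicator (by exact hA'm.compl)]
  refine lintegral_congr_ae ?_
  filter_upwards [hV.2 x k hx (U.symm hfL.toLp), Lp.coeFn_sub f (V x (U.symm hfL.toLp)),
    ae_restrict_of_ae h2] with y h3 h4 h5
  rw [h4, Pi.sub_apply, h3]
  by_cases hy : y ∈ A'
  · rw [Set.indicator_of_notMem (by exact not_not.2 hy), Set.indicator_of_mem hy]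
    have h6 : _ = f y := h5 hy
    rw [← h6]
    simp [shiftDensity, subMeasurableEquiv]
  · rw [Set.indicator_of_mem (by exact hy), Set.indicator_of_notMem (by exact hy), sub_zero]

end RangeProjection

/-- The spectral measure of `f`, in the coordinates `y - a` of `ℝ₊^ℕ`. -/
noncomputable def spectralMeasure (a : ℕ → ℝ) (ν : Measure (ℕ → ℝ)) (f : (ℕ → ℝ) → ℂ) :
    Measure (ℕ → NNReal) :=
  (ν.withDensity fun y => ‖f y‖ₑ ^ 2).map fun y n => (y n - a n).toNNReal

theorem measurable_toNNReal_sub (a : ℕ → ℝ) :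
    Measurable fun (y : ℕ → ℝ) n => (y n - a n).toNNReal := by fun_prop

theorem spectralMeasure_univ (a : ℕ → ℝ) {ν : Measure (ℕ → ℝ)} (f : Lp ℂ 2 ν) :
    spectralMeasure a ν f Set.univ = ‖f‖ₑ ^ 2 := by
  rw [spectralMeasure, Measure.map_apply (measurable_toNNReal_sub a) .univ, enorm_sq_eq_lintegral]
  simp

instance isFiniteMeasure_spectralMeasure (a : ℕ → ℝ) {ν : Measure (ℕ → ℝ)} (f : Lp ℂ 2 ν) :
    IsFiniteMeasure (spectralMeasure a ν f) :=
  ⟨by rw [spectralMeasure_univ]; exact ENNReal.pow_lt_top enorm_lt_top⟩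

theorem spectralMeasure_compl_Ici (a : ℕ → ℝ) (f : (ℕ → ℝ) → ℂ) {A : Set (ℕ → ℝ)}
    (hA : A = {y | ∀ n, a n ≤ y n}) (x : ℕ → NNReal) :
    spectralMeasure a (stdGaussianSeq.restrict A) f (Set.Ici x)ᶜ
      = ∫⁻ y in {y : ℕ → ℝ | (fun n => y n - (x n : ℝ)) ∉ A}, ‖f y‖ₑ ^ 2
        ∂stdGaussianSeq.restrict A := by
  have hAm : MeasurableSet A := hA ▸ measurableSet_forall_le a
  have hpre : MeasurableSet ((fun (y : ℕ → ℝ) n => (y n - a n).toNNReal) ⁻¹' (Set.Ici x)ᶜ) :=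
    measurable_toNNReal_sub a measurableSet_Ici.compl
  rw [spectralMeasure, Measure.map_apply (measurable_toNNReal_sub a) measurableSet_Ici.compl,
    withDensity_apply _ hpre]
  refine setLIntegral_congr ?_
  filter_upwards [ae_restrict_mem hAm] with y hy
  rw [hA] at hy
  refine propext (not_congr (?_ : x ≤ _ ↔ _ ∈ A))
  rw [hA]
  refine forall_congr' fun n => ?_
  rw [Real.le_toNNReal_iff_coe_le (sub_nonneg.2 (hy n))]
  constructor <;> intro <;> linarith

theorem generateFrom_Ici_finite :
    (MeasurableSpace.pi : MeasurableSpace (ℕ → NNReal)) = MeasurableSpace.generateFrom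
      {s | ∃ x : ℕ → NNReal, (∃ k, ∀ n, k ≤ n → x n = 0) ∧ s = Set.Ici x} := by
  refine le_antisymm (iSup_le fun n => ?_) (MeasurableSpace.generateFrom_le ?_)
  · rw [← measurable_iff_comap_le]
    refine @measurable_of_Ici NNReal _ _ _ _ (_) _ _ inferInstance _ fun c => ?_
    refine MeasurableSpace.measurableSet_generateFrom
      ⟨Pi.single n c, ⟨n + 1, fun m hm => Pi.single_eq_of_ne (by omega) _⟩, ?_⟩
    ext z
    constructor
    · intro hz m
      by_cases hm : m = n
      · subst hm; simpa using hz
      · simp [Pi.single_eq_of_ne hm]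
    · intro hz
      simpa using hz n
  · rintro _ ⟨x, -, rfl⟩
    exact measurableSet_Ici

theorem spectralMeasure_eq_of_intertwines {a b : ℕ → ℝ} {A B : Set (ℕ → ℝ)}
    (hA : A = {y | ∀ n, a n ≤ y n}) (hB : B = {y | ∀ n, b n ≤ y n})
    {VA : (ℕ → NNReal) → (Lp ℂ 2 (stdGaussianSeq.restrict A) →L[ℂ]
      Lp ℂ 2 (stdGaussianSeq.restrict A))} (hVA : IsGaussianShiftRep stdGaussianSeq A VA)
    {VB : (ℕ → NNReal) → (Lp ℂ 2 (stdGaussianSeq.restrict B) →L[ℂ]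
      Lp ℂ 2 (stdGaussianSeq.restrict B))} (hVB : IsGaussianShiftRep stdGaussianSeq B VB)
    (U : Lp ℂ 2 (stdGaussianSeq.restrict A) ≃ₗᵢ[ℂ] Lp ℂ 2 (stdGaussianSeq.restrict B))
    (hU : ∀ x : ℕ → NNReal, (∃ k, ∀ n, k ≤ n → x n = 0) → ∀ f, U (VA x f) = VB x (U f))
    (f : Lp ℂ 2 (stdGaussianSeq.restrict A)) :
    spectralMeasure a (stdGaussianSeq.restrict A) f
      = spectralMeasure b (stdGaussianSeq.restrict B) (U f) := by
  have hAm : MeasurableSet A := hA ▸ measurableSet_forall_le a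
  have hBm : MeasurableSet B := hB ▸ measurableSet_forall_le b
  have huniv : spectralMeasure a (stdGaussianSeq.restrict A) f Set.univ
      = spectralMeasure b (stdGaussianSeq.restrict B) (U f) Set.univ := by
    rw [spectralMeasure_univ, spectralMeasure_univ, LinearIsometryEquiv.enorm_map]
  refine ext_of_generate_finite _ generateFrom_Ici_finite ?_ ?_ huniv
  · rintro _ ⟨x, ⟨k, hk⟩, rfl⟩ _ ⟨x', ⟨k', hk'⟩, rfl⟩ -
    refine ⟨x ⊔ x', ⟨max k k', fun n hn => ?_⟩, Set.Ici_inter_Ici⟩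
    simp [hk n (le_of_max_le_left hn), hk' n (le_of_max_le_right hn)]
  · rintro _ ⟨x, ⟨k, hk⟩, rfl⟩
    have hnorm : ∀ g, ‖U f - VB x (U g)‖ₑ = ‖f - VA x g‖ₑ := fun g => by
      rw [← hU x ⟨k, hk⟩, ← map_sub, LinearIsometryEquiv.enorm_map]
    have hcompl : spectralMeasure a (stdGaussianSeq.restrict A) f (Set.Ici x)ᶜ
        = spectralMeasure b (stdGaussianSeq.restrict B) (U f) (Set.Ici x)ᶜ := by
      rw [spectralMeasure_compl_Ici a f hA, spectralMeasure_compl_Ici b (U f) hB]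
      obtain ⟨g, hg⟩ := exists_setLIntegral_eq_enorm_sub_sq hVA hAm hk
        (fun y hy => by
          rw [hA] at hy ⊢
          exact fun n => (hy n).trans (sub_le_self _ (x n).2)) f
      obtain ⟨g', hg'⟩ := exists_setLIntegral_eq_enorm_sub_sq hVB hBm hk
        (fun y hy => by
          rw [hB] at hy ⊢
          exact fun n => (hy n).trans (sub_le_self _ (x n).2)) (U f)
      refine le_antisymm ?_ ?_
      · rw [hg', ← U.apply_symm_apply g', hnorm]
        exact setLIntegral_le_enorm_sub_sq hVA hAm hk f _
      · rw [hg, ← hnorm]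
        exact setLIntegral_le_enorm_sub_sq hVB hBm hk (U f) _
    rw [← compl_compl (Set.Ici x), measure_compl measurableSet_Ici.compl (measure_ne_top _ _),
      measure_compl measurableSet_Ici.compl (measure_ne_top _ _), hcompl, huniv]

theorem measure_le_sum_le (h : ℕ → ℝ) (N : ℕ) :
    stdGaussianSeq {y | (∑ n ∈ Finset.range N, h n ^ 2) / 2 ≤ ∑ n ∈ Finset.range N, h n * y n}
      ≤ ENNReal.ofReal (Real.exp (-(∑ n ∈ Finset.range N, h n ^ 2) / 8)) := by
  set σ := ∑ n ∈ Finset.range N, h n ^ 2 with hσ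
  have hd : ∀ y, shiftDensity (fun n => h n / 2) N y
      = Real.exp ((∑ n ∈ Finset.range N, h n * y n) / 2 - σ / 8) := by
    intro y
    rw [shiftDensity, ← Real.exp_sum, hσ, Finset.sum_div, Finset.sum_div, ← Finset.sum_sub_distrib]
    refine congrArg _ (Finset.sum_congr rfl fun n _ => ?_)
    ring
  have hsub : {y : ℕ → ℝ | σ / 2 ≤ ∑ n ∈ Finset.range N, h n * y n}
      ⊆ {y | ENNReal.ofReal (Real.exp (σ / 8))
        ≤ ENNReal.ofReal (shiftDensity (fun n => h n / 2) N y)} := by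
    intro y (hy : σ / 2 ≤ _)
    refine ENNReal.ofReal_le_ofReal ?_
    rw [hd]
    exact Real.exp_le_exp.2 (by linarith)
  refine (measure_mono hsub).trans ((meas_ge_le_lintegral_div
    (measurable_shiftDensity _ _).ennreal_ofReal.aemeasurable (by simp [Real.exp_pos])
    ENNReal.ofReal_ne_top).trans (le_of_eq ?_))
  rw [lintegral_shiftDensity, neg_div, Real.exp_neg, ENNReal.ofReal_inv_of_pos (Real.exp_pos _),
    one_div]

/-- Translation by a sequence that is not square-summable gives a singular measure. -/
theorem exists_separating_set_of_not_summable {h : ℕ → ℝ} (hh : ¬ Summable fun n => h n ^ 2) :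
    ∃ G : Set (ℕ → ℝ), MeasurableSet G ∧ stdGaussianSeq G = 0 ∧
      stdGaussianSeq {y | (fun n => y n + h n) ∉ G} = 0 := by
  have htop : Tendsto (fun N => ∑ n ∈ Finset.range N, h n ^ 2) atTop atTop :=
    (not_summable_iff_tendsto_nat_atTop_of_nonneg fun n => sq_nonneg _).1 hh
  choose N hN using fun j : ℕ => (htop.eventually_ge_atTop (8 * (j : ℝ))).exists
  set E : ℕ → Set (ℕ → ℝ) := fun j => {y | (∑ n ∈ Finset.range (N j), h n ^ 2) / 2
    ≤ ∑ n ∈ Finset.range (N j), h n * y n} with hE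
  have hEm : ∀ j, MeasurableSet (E j) := fun j =>
    measurableSet_le measurable_const (by fun_prop)
  have hsum : ∀ F : ℕ → Set (ℕ → ℝ),
      (∀ j, stdGaussianSeq (F j)
        ≤ ENNReal.ofReal (Real.exp (-(∑ n ∈ Finset.range (N j), h n ^ 2) / 8))) →
      stdGaussianSeq (limsup F atTop) = 0 := by
    intro F hF
    refine measure_limsup_atTop_eq_zero (ne_top_of_le_ne_top
      Real.summable_exp_neg_nat.tsum_ofReal_ne_top (ENNReal.tsum_le_tsum fun j => (hF j).trans ?_))
    exact ENNReal.ofReal_le_ofReal (Real.exp_le_exp.2 (by linarith [hN j]))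
  refine ⟨limsup E atTop, MeasurableSet.measurableSet_limsup hEm,
    hsum E fun j => measure_le_sum_le h (N j), measure_mono_null ?_
      (hsum (fun j => {y | (∑ n ∈ Finset.range (N j), h n ^ 2) / 2
        ≤ ∑ n ∈ Finset.range (N j), -h n * y n}) fun j => ?_)⟩
  · intro y (hy : (fun n => y n + h n) ∉ limsup E atTop)
    rw [mem_limsup_iff_frequently_mem, not_frequently] at hy
    rw [mem_limsup_iff_frequently_mem]
    refine (hy.mono fun j hj => ?_).frequently
    simp only [hE, Set.mem_ofPred_eq, not_le, mul_add, Finset.sum_add_distrib, ← sq,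
      neg_mul, Finset.sum_neg_distrib] at hj ⊢
    linarith
  · simpa using measure_le_sum_le (fun n => -h n) (N j)

theorem measure_forall_le_pos {a : ℕ → ℝ}
    (ha : ∃ L : ℝ, 0 < L ∧ Tendsto (fun N : ℕ => ∏ n ∈ Finset.range N,
      (ProbabilityTheory.gaussianReal 0 1 (Set.Ici (a n))).toReal) atTop (𝓝 L)) :
    stdGaussianSeq {y | ∀ n, a n ≤ y n} ≠ 0 := by
  obtain ⟨L, hL, hlim⟩ := ha
  set S : ℕ → Set (ℕ → ℝ) := fun N => Set.pi (Finset.range N : Set ℕ) fun n => Set.Ici (a n)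
  have hSm : ∀ N, MeasurableSet (S N) := fun N =>
    MeasurableSet.pi (Finset.range N).countable_toSet fun n _ => measurableSet_Ici
  have hS : {y : ℕ → ℝ | ∀ n, a n ≤ y n} = ⋂ N, S N := by
    ext y
    simp only [S, Set.mem_iInter, Set.mem_pi, Set.mem_ofPred_eq, Finset.mem_coe, Finset.mem_range,
      Set.mem_Ici]
    exact ⟨fun hy _ n _ => hy n, fun hy n => hy (n + 1) n n.lt_succ_self⟩
  have hanti : Antitone S := fun N M hNM y hy n hn => hy n (Finset.range_mono hNM hn)
  have h1 := tendsto_measure_iInter_atTop (μ := stdGaussianSeq)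
    (fun N => (hSm N).nullMeasurableSet) hanti ⟨0, measure_ne_top _ _⟩
  have h2 := (ENNReal.tendsto_toReal (measure_ne_top _ _)).comp h1
  have h3 : ∀ N, (stdGaussianSeq (S N)).toReal = ∏ n ∈ Finset.range N,
      (ProbabilityTheory.gaussianReal 0 1 (Set.Ici (a n))).toReal := fun N => by
    rw [stdGaussianSeq, Measure.infinitePi_pi _ fun _ _ => measurableSet_Ici, ENNReal.toReal_prod]
  have h4 := tendsto_nhds_unique (h2.congr h3) hlim
  rw [hS]
  intro h0
  rw [h0, ENNReal.toReal_zero] at h4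
  exact hL.ne h4

theorem summable_of_spectralMeasure_eq {a b : ℕ → ℝ} {A B : Set (ℕ → ℝ)}
    (hA : A = {y | ∀ n, a n ≤ y n}) (hB : B = {y | ∀ n, b n ≤ y n})
    (hA0 : stdGaussianSeq A ≠ 0) {g : (ℕ → ℝ) → ℂ}
    (hg : spectralMeasure a (stdGaussianSeq.restrict A) (fun _ => 1)
      = spectralMeasure b (stdGaussianSeq.restrict B) g) :
    Summable fun n => (a n - b n) ^ 2 := by
  have hAm : MeasurableSet A := hA ▸ measurableSet_forall_le a
  have hBm : MeasurableSet B := hB ▸ measurableSet_forall_le b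
  by_contra hns
  obtain ⟨G, hGm, hG0, hG1⟩ := exists_separating_set_of_not_summable
    (h := fun n => b n - a n) (by simpa only [sub_sq_comm] using hns)
  set E : Set (ℕ → NNReal) := {z | (fun n => (z n : ℝ) + b n) ∈ G} with hE
  have hEm : MeasurableSet E :=
    (show Measurable fun (z : ℕ → NNReal) n => (z n : ℝ) + b n by fun_prop) hGm
  have hBE : spectralMeasure b (stdGaussianSeq.restrict B) g E = 0 := by
    rw [spectralMeasure, Measure.map_apply (measurable_toNNReal_sub b) hEm]
    refine withDensity_absolutelyContinuous _ _ ?_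
    rw [Measure.restrict_apply (measurable_toNNReal_sub b hEm)]
    refine measure_mono_null ?_ hG0
    rintro y ⟨hy : (fun n => (((y n - b n).toNNReal : NNReal) : ℝ) + b n) ∈ G, hyB⟩
    rw [hB] at hyB
    simpa [Real.coe_toNNReal _ (sub_nonneg.2 (hyB _))] using hy
  have hAE : spectralMeasure a (stdGaussianSeq.restrict A) (fun _ => 1) Eᶜ = 0 := by
    rw [spectralMeasure, Measure.map_apply (measurable_toNNReal_sub a) hEm.compl]
    refine withDensity_absolutelyContinuous _ _ ?_
    rw [Measure.restrict_apply (measurable_toNNReal_sub a hEm.compl)]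
    refine measure_mono_null ?_ hG1
    rintro y ⟨hy : (fun n => (((y n - a n).toNNReal : NNReal) : ℝ) + b n) ∉ G, hyA⟩
    rw [hA] at hyA
    simp only [Real.coe_toNNReal _ (sub_nonneg.2 (hyA _))] at hy
    convert hy using 3
    ring_nf
  refine hA0 ?_
  have h0 : spectralMeasure a (stdGaussianSeq.restrict A) (fun _ => 1) Set.univ = 0 := by
    rw [← Set.union_compl_self E, measure_union_null_iff, hAE, hg, hBE]
    simp
  rw [spectralMeasure, Measure.map_apply (measurable_toNNReal_sub a) .univ] at h0
  simpa using h0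

/-- `V^A` and `V^B` are unitarily equivalent iff `Σ (a_n - b_n)² < ∞`. -/
theorem stmt_17 (μ : Measure (ℕ → ℝ)) (hμ : IsGaussianProduct μ)
    (a b : ℕ → ℝ) (ha : ∀ n, a n ≤ 0) (hb : ∀ n, b n ≤ 0)
    (hproda : ∃ L : ℝ, 0 < L ∧
      Tendsto (fun N : ℕ => ∏ n ∈ Finset.range N,
          (ProbabilityTheory.gaussianReal 0 1 (Set.Ici (a n))).toReal) atTop (𝓝 L))
    (hprodb : ∃ L : ℝ, 0 < L ∧
      Tendsto (fun N : ℕ => ∏ n ∈ Finset.range N,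
          (ProbabilityTheory.gaussianReal 0 1 (Set.Ici (b n))).toReal) atTop (𝓝 L))
    (A : Set (ℕ → ℝ)) (hA : A = {y : ℕ → ℝ | ∀ n, a n ≤ y n})
    (B : Set (ℕ → ℝ)) (hB : B = {y : ℕ → ℝ | ∀ n, b n ≤ y n})
    (VA : (ℕ → NNReal) → (Lp ℂ 2 (μ.restrict A) →L[ℂ] Lp ℂ 2 (μ.restrict A)))
    (hVA : IsGaussianShiftRep μ A VA)
    (VB : (ℕ → NNReal) → (Lp ℂ 2 (μ.restrict B) →L[ℂ] Lp ℂ 2 (μ.restrict B)))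
    (hVB : IsGaussianShiftRep μ B VB) :
    (∃ U : Lp ℂ 2 (μ.restrict A) ≃ₗᵢ[ℂ] Lp ℂ 2 (μ.restrict B),
      ∀ x : ℕ → NNReal, (∃ k, ∀ n, k ≤ n → x n = 0) →
        ∀ f : Lp ℂ 2 (μ.restrict A), U (VA x f) = VB x (U f)) ↔
    Summable (fun n => (a n - b n) ^ 2) := by
  obtain rfl := hμ.eq_stdGaussianSeq
  refine ⟨fun ⟨U, hU⟩ => ?_, exists_intertwiner_of_summable hA hB hVA hVB⟩
  have h1 : MemLp (fun _ => (1 : ℂ)) 2 (stdGaussianSeq.restrict A) := memLp_const 1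
  have hspec := spectralMeasure_eq_of_intertwines hA hB hVA hVB U hU h1.toLp
  refine summable_of_spectralMeasure_eq hA hB (hA ▸ measure_forall_le_pos hproda)
    (g := U h1.toLp) (hspec ▸ ?_)
  unfold spectralMeasure
  congr 1
  refine withDensity_congr_ae ?_
  filter_upwards [h1.coeFn_toLp] with y hy
  rw [hy]
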